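/- Let d ∈ ℕ, let ‖·‖_B be a norm on ℝ^d with unit ball B, and let D ⊂ ℝ^d be a bounded Jordan measurable set with λ^d(D) > 0. Then for every n ∈ ℕ, e(n, F^B(D)) ≥ (d/(d+1)) · λ^d(B)^{−1/d} · λ^d(D)^{(d+1)/d} · n^{−1/d}. -/

import Mathlib

open MeasureTheory

/-- The Lipschitz class `F^B(D)` with respect to the norm `N` (unit ball `B`):
all `f : D → ℝ` with `|f(x) - f(y)| ≤ ‖x - y‖_B`. -/
def FB (d : ℕ) (N : Seminorm ℝ (Fin d → ℝ)) (D : Set (Fin d → ℝ)) :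
    Set ((Fin d → ℝ) → ℝ) :=
  { f | ∀ x ∈ D, ∀ y ∈ D, |f x - f y| ≤ N (x - y) }

/-- The `n`-th minimal worst-case error of numerical integration on the class `F` over `D`:
`e(n,F) = inf_{x₁,…,xₙ ∈ D} sup{ ∫_D f : f ∈ F, f(x₁) = ⋯ = f(xₙ) = 0 }`. -/
noncomputable def interr {d : ℕ} (D : Set (Fin d → ℝ))
    (F : Set ((Fin d → ℝ) → ℝ)) (n : ℕ) : ℝ :=
  ⨅ x : Fin n → D, sSup ((fun f => ∫ t in D, f t) ''
    {f | f ∈ F ∧ ∀ i, f ((x i : Fin d → ℝ)) = 0})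

/-- Layer-cake lower bound: if `0 ≤ f ≤ R` and the sublevel sets `{f < t}` have measure at most
`c * t ^ d`, then `∫ f ≥ R * μ(univ) - c * R ^ (d + 1) / (d + 1)`. -/
theorem le_integral_of_measure_lt_le_mul_pow {α : Type*} [MeasurableSpace α] {μ : Measure α}
    [IsFiniteMeasure μ] {f : α → ℝ} (hf : Measurable f) {R c : ℝ} (hR : 0 ≤ R)
    (hf0 : ∀ x, 0 ≤ f x) (hfR : ∀ x, f x ≤ R) (d : ℕ)
    (hc : ∀ t ∈ Set.Ioo 0 R, μ.real {x | f x < t} ≤ c * t ^ d) :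
    R * μ.real Set.univ - c * (R ^ (d + 1) / (d + 1)) ≤ ∫ x, f x ∂μ := by
  have hint : Integrable f μ := Integrable.of_bound hf.aestronglyMeasurable R
    (Filter.Eventually.of_forall fun x => by
      rw [Real.norm_eq_abs, abs_of_nonneg (hf0 x)]; exact hfR x)
  have hmeas : Antitone fun t : ℝ => μ.real {x | t ≤ f x} := fun s t hst =>
    measureReal_mono fun x (hx : t ≤ f x) => hst.trans hx
  rw [hint.integral_eq_integral_Ioc_meas_le (Filter.Eventually.of_forall hf0)
    (Filter.Eventually.of_forall hfR), ← intervalIntegral.integral_of_le hR]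
  have hcalc : ∫ t in (0 : ℝ)..R, (μ.real Set.univ - c * t ^ d) =
      R * μ.real Set.univ - c * (R ^ (d + 1) / (d + 1)) := by
    rw [intervalIntegral.integral_sub intervalIntegrable_const
      ((by fun_prop : Continuous fun t : ℝ => c * t ^ d).intervalIntegrable _ _)]
    simp
  rw [← hcalc]
  refine intervalIntegral.integral_mono_on_of_le_Ioo hR
    ((by fun_prop : Continuous fun t : ℝ => μ.real Set.univ - c * t ^ d).intervalIntegrable _ _)
    hmeas.intervalIntegrable fun t ht => ?_
  have hcompl : {x | t ≤ f x} = {x | f x < t}ᶜ := by ext; simp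
  rw [hcompl, measureReal_compl (measurableSet_lt hf measurable_const)]
  linarith [hc t ht]

namespace Seminorm

theorem continuous_pi {d : ℕ} (N : Seminorm ℝ (Fin d → ℝ)) : Continuous N :=
  continuousOn_univ.1 (N.convexOn.continuousOn isOpen_univ)

theorem exists_norm_le_mul {E : Type*} [NormedAddCommGroup E] [NormedSpace ℝ E] [ProperSpace E]
    (N : Seminorm ℝ E) (hcont : Continuous N) (hN : ∀ x, N x = 0 → x = 0) :
    ∃ C : ℝ, ∀ x, ‖x‖ ≤ C * N x := by
  rcases (Metric.sphere (0 : E) 1).eq_empty_or_nonempty with h | h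
  · refine ⟨0, fun x => ?_⟩
    by_contra! hx
    have hx0 : x ≠ 0 := by rintro rfl; simp at hx
    have : ‖x‖⁻¹ • x ∈ Metric.sphere (0 : E) 1 := by simp [norm_smul, hx0]
    simp [h] at this
  · obtain ⟨z, hz, hmin⟩ := (isCompact_sphere (0 : E) 1).exists_isMinOn h hcont.continuousOn
    have hNz : 0 < N z := (apply_nonneg N z).lt_of_ne' fun h0 => by
      rw [hN z h0] at hz; simp at hz
    refine ⟨(N z)⁻¹, fun x => ?_⟩
    rcases eq_or_ne x 0 with rfl | hx0
    · simp
    have hx : 0 < ‖x‖ := norm_pos_iff.2 hx0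
    have hmem : ‖x‖⁻¹ • x ∈ Metric.sphere (0 : E) 1 := by simp [norm_smul, hx0]
    have hle : N z ≤ N (‖x‖⁻¹ • x) := hmin hmem
    rw [map_smul_eq_mul, norm_inv, norm_norm, inv_mul_eq_div, le_div_iff₀ hx] at hle
    rwa [inv_mul_eq_div, le_div_iff₀ hNz, mul_comm]

theorem volume_unitBall_lt_top {d : ℕ} (N : Seminorm ℝ (Fin d → ℝ))
    (hN : ∀ x, N x = 0 → x = 0) : volume {x : Fin d → ℝ | N x ≤ 1} < ⊤ := by
  obtain ⟨C, hC⟩ := N.exists_norm_le_mul N.continuous_pi hN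
  refine Bornology.IsBounded.measure_lt_top
    ((Metric.isBounded_closedBall (x := 0) (r := |C|)).subset fun x (hx : N x ≤ 1) => ?_)
  rw [mem_closedBall_zero_iff]
  calc ‖x‖ ≤ C * N x := hC x
    _ ≤ |C| * 1 := mul_le_mul (le_abs_self C) hx (apply_nonneg N x) (abs_nonneg C)
    _ = |C| := mul_one _

theorem volume_unitBall_pos {d : ℕ} (N : Seminorm ℝ (Fin d → ℝ)) :
    0 < volume {x : Fin d → ℝ | N x ≤ 1} :=
  ((isOpen_lt N.continuous_pi continuous_const).measure_pos volume
    ⟨0, by simp⟩).trans_le (measure_mono fun x (hx : N x < 1) => hx.le)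

theorem volume_real_le {d : ℕ} (N : Seminorm ℝ (Fin d → ℝ)) (c : Fin d → ℝ) {t : ℝ}
    (ht : 0 < t) :
    volume.real {x : Fin d → ℝ | N (x - c) ≤ t} =
      t ^ d * volume.real {x : Fin d → ℝ | N x ≤ 1} := by
  have hpre : {x : Fin d → ℝ | N (x - c) ≤ t} =
      (fun x => x - c) ⁻¹' ((t⁻¹ • ·) ⁻¹' {x : Fin d → ℝ | N x ≤ 1}) := by
    ext x
    simp only [Set.mem_ofPred_eq, Set.mem_preimage, map_smul_eq_mul, norm_inv, Real.norm_eq_abs,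
      abs_of_pos ht, inv_mul_le_iff₀ ht, mul_one]
  simp only [sub_eq_add_neg] at hpre ⊢
  rw [measureReal_def, hpre, measure_preimage_add_right,
    Measure.addHaar_preimage_smul _ (inv_ne_zero ht.ne'), ENNReal.toReal_mul, measureReal_def,
    Module.finrank_fin_fun, inv_pow, inv_inv, abs_of_pos (pow_pos ht d),
    ENNReal.toReal_ofReal (pow_pos ht d).le]

end Seminorm

/-- The distance, with respect to `N`, to the nearest of the points `x i`, truncated at `R`. -/
noncomputable def truncDist {d n : ℕ} [NeZero n] (N : Seminorm ℝ (Fin d → ℝ))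
    (x : Fin n → Fin d → ℝ) (R : ℝ) (t : Fin d → ℝ) : ℝ :=
  min R (Finset.univ.inf' Finset.univ_nonempty fun i => N (t - x i))

section truncDist

variable {d n : ℕ} [NeZero n] (N : Seminorm ℝ (Fin d → ℝ)) (x : Fin n → Fin d → ℝ) (R : ℝ)

theorem continuous_truncDist : Continuous (truncDist N x R) :=
  continuous_const.min <| Continuous.finset_inf'_apply _ fun _ _ =>
    N.continuous_pi.comp (continuous_id.sub continuous_const)

theorem truncDist_le_add (s t : Fin d → ℝ) :
    truncDist N x R s ≤ truncDist N x R t + N (s - t) := by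
  have hst := apply_nonneg N (s - t)
  obtain ⟨i, -, hi⟩ := Finset.exists_mem_eq_inf' (Finset.univ_nonempty (α := Fin n))
    fun i => N (t - x i)
  rw [truncDist, truncDist, hi, ← min_add_add_right]
  refine min_le_min (by linarith) ((Finset.inf'_le _ (Finset.mem_univ i)).trans ?_)
  calc N (s - x i) = N ((t - x i) + (s - t)) := by congr 1; abel
    _ ≤ _ := map_add_le_add N _ _

theorem truncDist_mem_FB (D : Set (Fin d → ℝ)) : truncDist N x R ∈ FB d N D := by
  intro s _ t _
  have h1 := truncDist_le_add N x R s t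
  have h2 := truncDist_le_add N x R t s
  rw [map_sub_rev] at h2
  exact abs_sub_le_iff.2 ⟨by linarith, by linarith⟩

variable {R}

theorem truncDist_nonneg (hR : 0 ≤ R) (t : Fin d → ℝ) : 0 ≤ truncDist N x R t :=
  le_min hR (Finset.le_inf' _ _ fun _ _ => apply_nonneg N _)

theorem truncDist_apply_self (hR : 0 ≤ R) (i : Fin n) : truncDist N x R (x i) = 0 := by
  refine le_antisymm ((min_le_right _ _).trans ?_) (truncDist_nonneg N x hR _)
  exact (Finset.inf'_le _ (Finset.mem_univ i)).trans_eq (by simp)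

variable (R) in
theorem setOf_truncDist_lt_subset {t : ℝ} (ht : t ≤ R) :
    {y | truncDist N x R y < t} ⊆ ⋃ i, {y | N (y - x i) ≤ t} := by
  intro y hy
  rcases min_lt_iff.1 (show truncDist N x R y < t from hy) with h | h
  · exact absurd h ht.not_gt
  · obtain ⟨i, -, hi⟩ := (Finset.inf'_lt_iff _).1 h
    exact Set.mem_iUnion.2 ⟨i, hi.le⟩

end truncDist

theorem le_setIntegral_truncDist {d n : ℕ} [NeZero n] (N : Seminorm ℝ (Fin d → ℝ))
    (hN : ∀ x, N x = 0 → x = 0) {D : Set (Fin d → ℝ)} (hD : volume D < ⊤)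
    (x : Fin n → Fin d → ℝ) {R : ℝ} (hR : 0 ≤ R) :
    R * volume.real D - n * volume.real {x : Fin d → ℝ | N x ≤ 1} * (R ^ (d + 1) / (d + 1)) ≤
      ∫ t in D, truncDist N x R t := by
  have : IsFiniteMeasure (volume.restrict D) := ⟨by simpa using hD⟩
  have hball (t : ℝ) (ht : 0 < t) (i : Fin n) :
      volume {y : Fin d → ℝ | N (y - x i) ≤ t} ≠ ⊤ := by
    have h := N.volume_real_le (x i) ht
    have hpos : 0 < volume.real {x : Fin d → ℝ | N x ≤ 1} :=
      ENNReal.toReal_pos N.volume_unitBall_pos.ne' (N.volume_unitBall_lt_top hN).ne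
    intro htop
    rw [measureReal_def, htop, ENNReal.toReal_top] at h
    exact (mul_pos (pow_pos ht d) hpos).ne h
  have key := le_integral_of_measure_lt_le_mul_pow (μ := volume.restrict D)
    (continuous_truncDist N x R).measurable hR (truncDist_nonneg N x hR)
    (fun _ => min_le_left _ _) d (c := n * volume.real {x : Fin d → ℝ | N x ≤ 1})
    fun t ht => ?_
  · simpa [measureReal_restrict_apply] using key
  · have hU : volume (⋃ i, {y | N (y - x i) ≤ t}) ≠ ⊤ :=
      ((measure_iUnion_fintype_le _ _).trans_lt
        (ENNReal.sum_lt_top.2 fun i _ => (hball t ht.1 i).lt_top)).ne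
    calc (volume.restrict D).real {y | truncDist N x R y < t}
        ≤ volume.real {y | truncDist N x R y < t} :=
          ENNReal.toReal_mono
            ((measure_mono (setOf_truncDist_lt_subset N x R ht.2.le)).trans_lt hU.lt_top).ne
            (Measure.restrict_apply_le _ _)
      _ ≤ volume.real (⋃ i, {y | N (y - x i) ≤ t}) :=
          measureReal_mono (setOf_truncDist_lt_subset N x R ht.2.le) hU
      _ ≤ ∑ i, volume.real {y | N (y - x i) ≤ t} := measureReal_iUnion_fintype_le _
      _ = n * volume.real {x : Fin d → ℝ | N x ≤ 1} * t ^ d := by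
          simp only [N.volume_real_le _ ht.1, Finset.sum_const, Finset.card_univ,
            Fintype.card_fin, nsmul_eq_mul]
          ring

theorem bddAbove_setIntegral_FB {d : ℕ} (N : Seminorm ℝ (Fin d → ℝ)) {D : Set (Fin d → ℝ)}
    (hDb : Bornology.IsBounded D) {p : Fin d → ℝ} (hp : p ∈ D) :
    BddAbove ((fun f => ∫ t in D, f t) '' {f | f ∈ FB d N D ∧ f p = 0}) := by
  have hcpt : IsCompact (closure D) := hDb.isCompact_closure
  obtain ⟨C, hC⟩ := hcpt.bddAbove_image
    (N.continuous_pi.comp (continuous_id.sub (continuous_const (y := p)))).continuousOn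
  refine ⟨C * volume.real D, ?_⟩
  rintro _ ⟨f, ⟨hf, hfp⟩, rfl⟩
  refine (Real.le_norm_self _).trans (norm_setIntegral_le_of_norm_le_const hDb.measure_lt_top
    fun t ht => ?_)
  have h := hf t ht p hp
  rw [hfp, sub_zero] at h
  exact h.trans (hC ⟨t, subset_closure ht, rfl⟩)

theorem optimal_radius_identity {d n : ℕ} (hd : 0 < d) (hn : 0 < n) {b V : ℝ} (hb : 0 < b)
    (hV : 0 < V) :
    let R := (V / (n * b)) ^ ((1 : ℝ) / d)
    R * V - n * b * (R ^ (d + 1) / (d + 1)) =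
      (d : ℝ) / (d + 1) * b ^ (-(1 : ℝ) / d) * V ^ (((d : ℝ) + 1) / d) *
        (n : ℝ) ^ (-(1 : ℝ) / d) := by
  intro R
  have hd' : (0 : ℝ) < d := Nat.cast_pos.2 hd
  have hn' : (0 : ℝ) < n := Nat.cast_pos.2 hn
  have hRd : R ^ d = V / (n * b) := by
    rw [← Real.rpow_natCast, ← Real.rpow_mul (by positivity), one_div_mul_cancel hd'.ne',
      Real.rpow_one]
  have hRV : R * V = b ^ (-(1 : ℝ) / d) * V ^ (((d : ℝ) + 1) / d) * (n : ℝ) ^ (-(1 : ℝ) / d) := by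
    have hexp : ((d : ℝ) + 1) / d = 1 / d + 1 := by field_simp; ring
    rw [hexp, Real.rpow_add hV, Real.rpow_one, neg_div, Real.rpow_neg hb.le,
      Real.rpow_neg hn'.le]
    simp only [R]
    rw [Real.div_rpow hV.le (by positivity), Real.mul_rpow hn'.le hb.le]
    field_simp
  have hmain : R * V - n * b * (R ^ (d + 1) / (d + 1)) = d / (d + 1) * (R * V) := by
    rw [pow_succ, hRd]
    field_simp
    ring
  rw [hmain, hRV]
  ring

/-- Explicit uniform lower bound for integration of Lipschitz functions: for every bounded
Jordan measurable `D` with positive measure and every `n ≥ 1`,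
`e(n, F^B(D)) ≥ (d/(d+1)) λ(B)^{-1/d} λ(D)^{(d+1)/d} n^{-1/d}`. -/
theorem lipschitz_integration_uniform_lower_bound (d : ℕ) (hd : 0 < d)
    (N : Seminorm ℝ (Fin d → ℝ)) (hN : ∀ x, N x = 0 → x = 0)
    (D : Set (Fin d → ℝ)) (hDb : Bornology.IsBounded D)
    (hDJ : volume (frontier D) = 0) (hDpos : 0 < volume D)
    (n : ℕ) (hn : 0 < n) :
    (d : ℝ) / (d + 1) * (volume {x : Fin d → ℝ | N x ≤ 1}).toReal ^ (-(1 : ℝ) / d) *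
        (volume D).toReal ^ (((d : ℝ) + 1) / d) * (n : ℝ) ^ (-(1 : ℝ) / d)
      ≤ interr D (FB d N D) n := by
  have : NeZero n := ⟨hn.ne'⟩
  have hDfin : volume D < ⊤ := hDb.measure_lt_top
  obtain ⟨p, hp⟩ := nonempty_of_measure_ne_zero hDpos.ne'
  have : Nonempty D := ⟨⟨p, hp⟩⟩
  refine le_ciInf fun x => ?_
  have hb : 0 < volume.real {x : Fin d → ℝ | N x ≤ 1} :=
    ENNReal.toReal_pos N.volume_unitBall_pos.ne' (N.volume_unitBall_lt_top hN).ne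
  have hV : 0 < volume.real D := ENNReal.toReal_pos hDpos.ne' hDfin.ne
  have hR : 0 ≤ (volume.real D / (n * volume.real {x : Fin d → ℝ | N x ≤ 1})) ^ ((1 : ℝ) / d) := by
    positivity
  refine (optimal_radius_identity hd hn hb hV).ge.trans
    ((le_setIntegral_truncDist N hN hDfin (fun i => (x i : Fin d → ℝ)) hR).trans ?_)
  have hsub : {f | f ∈ FB d N D ∧ ∀ i, f (x i) = 0} ⊆ {f | f ∈ FB d N D ∧ f (x 0) = 0} :=
    fun f hf => ⟨hf.1, hf.2 0⟩
  refine le_csSup ((bddAbove_setIntegral_FB N hDb (x 0).2).mono (Set.image_mono hsub)) ?_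
  exact ⟨truncDist N _ _, ⟨truncDist_mem_FB N _ _ D, truncDist_apply_self N _ hR⟩, rfl⟩
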